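/- For d ≥ 2 and e = v_{d-1}v_d, the complete graph minus one edge satisfies Y_{K_d − e} ≡_d [(d−2)/(d−1)] e_{([d])} + [1/(d−1)] e_{([d-1]/d)}; in particular Y_{K_d − e} is (e)-positive, and in the commutative setting X_{K_d − e} = d(d−2)(d−2)! e_d + (d−2)! e_{(d−1,1)}. -/

import Mathlib

open Finset

attribute [local instance] Classical.propDecidable

/-- Homogeneous degree-`d` noncommutative symmetric functions, viewed as
coefficient functions on words of length `d` in the variables. -/
abbrev NCF (d : ℕ) := (Fin d → ℕ) → ℚ

/-- A coloring is proper for the edge family `ends` if the endpoints of every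
edge receive distinct colors. -/
def Proper {d : ℕ} {ε : Type*} {C : Type*} (ends : ε → Sym2 (Fin d)) (w : Fin d → C) : Prop :=
  ∀ (e : ε) (i j : Fin d), ends e = s(i, j) → w i ≠ w j

/-- The noncommutative chromatic symmetric function `Y_G`. -/
noncomputable def Y {d : ℕ} {ε : Type*} (ends : ε → Sym2 (Fin d)) : NCF d :=
  fun w => if Proper ends w then 1 else 0

/-- Noncommutative monomial symmetric function indexed by a set partition. -/
noncomputable def mFun {d : ℕ} (π : Setoid (Fin d)) : NCF d :=
  fun w => if (∀ i j, w i = w j ↔ π i j) then 1 else 0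

/-- Noncommutative power sum symmetric function indexed by a set partition. -/
noncomputable def pFun {d : ℕ} (π : Setoid (Fin d)) : NCF d :=
  fun w => if (∀ i j, π i j → w i = w j) then 1 else 0

/-- Noncommutative elementary symmetric function indexed by a set partition. -/
noncomputable def eFun {d : ℕ} (π : Setoid (Fin d)) : NCF d :=
  fun w => if (∀ i j, i ≠ j → π i j → w i ≠ w j) then 1 else 0

noncomputable instance setoidFintype (d : ℕ) : Fintype (Setoid (Fin d)) :=
  Fintype.ofInjective (fun s : Setoid (Fin d) => (s : Fin d → Fin d → Prop))
    (fun s t h => Setoid.ext fun a b => by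
      have := congrFun (congrFun h a) b; simpa using this.to_iff)

/-- Position action of a permutation on words/NCFs. -/
noncomputable def act {d : ℕ} (δ : Equiv.Perm (Fin d)) (f : NCF d) : NCF d :=
  fun w => f (w ∘ δ)

/-- The induction operator `↑`, repeating the last variable. -/
noncomputable def up {n : ℕ} (f : NCF (n + 1)) : NCF (n + 2) :=
  fun w => if w (Fin.last (n + 1)) = w ⟨n, by omega⟩ then f (fun i => w i.castSucc) else 0

/-- Vertex map collapsing the last vertex onto the next-to-last one (for contraction). -/
def collapse {n : ℕ} : Fin (n + 2) → Fin (n + 1) :=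
  fun i => if h : (i : ℕ) < n + 1 then ⟨i, h⟩ else ⟨n, by omega⟩

/-- The partition of `[d]` into connected components of the spanning subgraph with edge set `S`. -/
def components {d : ℕ} {ε : Type*} (ends : ε → Sym2 (Fin d)) (S : Finset ε) :
    Setoid (Fin d) :=
  Relation.EqvGen.setoid (fun i j => ∃ e ∈ S, ends e = s(i, j))

/-- The size of the block of `π` containing `i`. -/
noncomputable def blockCard {n : ℕ} (π : Setoid (Fin n)) (i : Fin n) : ℕ :=
  (Finset.univ.filter (fun j => π i j)).card

/-- The multiset of block sizes (the type `λ(π)`) of a set partition. -/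
noncomputable def sizes {n : ℕ} (π : Setoid (Fin n)) : Multiset ℕ :=
  (Finset.univ.image (fun i => Finset.univ.filter (fun j => π i j))).val.map Finset.card

/-- `σ ≡ᵢ τ` : same type and blocks containing `i` of equal size. -/
def cls {n : ℕ} (i : Fin n) (σ τ : Setoid (Fin n)) : Prop :=
  sizes σ = sizes τ ∧ blockCard σ i = blockCard τ i

/-- Congruence modulo `i` of noncommutative symmetric functions: the amalgamated
coefficients of their `e`-expansions agree on every `≡ᵢ`-class. -/
noncomputable def EquivI {n : ℕ} (i : Fin n) (F G : NCF n) : Prop :=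
  ∃ a b : Setoid (Fin n) → ℚ,
    F = ∑ τ : Setoid (Fin n), a τ • eFun τ ∧
    G = ∑ τ : Setoid (Fin n), b τ • eFun τ ∧
    ∀ τ, (∑ σ : Setoid (Fin n), if cls i σ τ then a σ else 0)
        = ∑ σ : Setoid (Fin n), if cls i σ τ then b σ else 0

/-- `(e)`-positivity with respect to the congruence modulo `i`. -/
noncomputable def EPos {n : ℕ} (i : Fin n) (F : NCF n) : Prop :=
  ∃ a : Setoid (Fin n) → ℚ,
    F = ∑ τ : Setoid (Fin n), a τ • eFun τ ∧
    ∀ τ, 0 ≤ ∑ σ : Setoid (Fin n), if cls i σ τ then a σ else 0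

/-- `(e)`-positivity of a labeled graph: for some labeling and some congruence. -/
noncomputable def EPosG {d : ℕ} {ε : Type*} (ends : ε → Sym2 (Fin d)) : Prop :=
  ∃ (δ : Equiv.Perm (Fin d)) (i : Fin d),
    EPos i (Y (fun e => (ends e).map δ))

/-- Extend a partition of `{0,…,n}` to one of `{0,…,n+m}`: old blocks are kept,
the new elements (indices `≥ n+1`) satisfying `Q` are merged into the block of
the old last element `n`, and the remaining new elements form singletons. -/
def extendB {n : ℕ} (m : ℕ) (π : Setoid (Fin (n + 1))) (Q : ℕ → Prop) :
    Setoid (Fin (n + 1 + m)) where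
  r x y := x = y ∨
    (∃ (hx : (x : ℕ) < n + 1) (hy : (y : ℕ) < n + 1), π ⟨x, hx⟩ ⟨y, hy⟩) ∨
    (((∃ hx : (x : ℕ) < n + 1, π ⟨x, hx⟩ (Fin.last n)) ∨ (n + 1 ≤ (x : ℕ) ∧ Q (x : ℕ))) ∧
     ((∃ hy : (y : ℕ) < n + 1, π ⟨y, hy⟩ (Fin.last n)) ∨ (n + 1 ≤ (y : ℕ) ∧ Q (y : ℕ))))
  iseqv := by
    constructor
    · intro x; exact Or.inl rfl
    · rintro x y (rfl | ⟨hx, hy, h⟩ | ⟨h1, h2⟩)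
      · exact Or.inl rfl
      · exact Or.inr (Or.inl ⟨hy, hx, π.symm h⟩)
      · exact Or.inr (Or.inr ⟨h2, h1⟩)
    · rintro x y z (rfl | ⟨hx, hy, h⟩ | ⟨h1, h2⟩) h'
      · exact h'
      · rcases h' with rfl | ⟨hy', hz, h''⟩ | ⟨h1', h2'⟩
        · exact Or.inr (Or.inl ⟨hx, hy, h⟩)
        · exact Or.inr (Or.inl ⟨hx, hz, π.trans h h''⟩)
        · rcases h1' with ⟨hy', hB⟩ | ⟨hge, _⟩
          · exact Or.inr (Or.inr ⟨Or.inl ⟨hx, π.trans h hB⟩, h2'⟩)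
          · omega
      · rcases h' with rfl | ⟨hy', hz, h''⟩ | ⟨h1', h2'⟩
        · exact Or.inr (Or.inr ⟨h1, h2⟩)
        · rcases h2 with ⟨hy2, hB⟩ | ⟨hge, _⟩
          · exact Or.inr (Or.inr ⟨h1, Or.inl ⟨hz, π.trans (π.trans (π.symm h'') hB) (π.refl _)⟩⟩)
          · omega
        · exact Or.inr (Or.inr ⟨h1, h2'⟩)

/-- `π + (n+1)` : insert the new element `n+1` into the block containing `n`. -/
def addLast {n : ℕ} (π : Setoid (Fin (n + 1))) : Setoid (Fin (n + 2)) :=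
  extendB 1 π (fun _ => True)

/-- `π / (n+1)` : add the new element `n+1` as a singleton block. -/
def addSingleton {n : ℕ} (π : Setoid (Fin (n + 1))) : Setoid (Fin (n + 2)) :=
  extendB 1 π (fun _ => False)

/-- `σ / (d+1),…,(d+m)` : add the new elements as one additional block. -/
def addBlock {d : ℕ} (m : ℕ) (σ : Setoid (Fin d)) : Setoid (Fin (d + m)) where
  r x y := (∃ (hx : (x : ℕ) < d) (hy : (y : ℕ) < d), σ ⟨x, hx⟩ ⟨y, hy⟩) ∨
    (d ≤ (x : ℕ) ∧ d ≤ (y : ℕ))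
  iseqv := by
    constructor
    · intro x
      by_cases h : (x : ℕ) < d
      · exact Or.inl ⟨h, h, σ.refl _⟩
      · exact Or.inr ⟨by omega, by omega⟩
    · rintro x y (⟨hx, hy, h⟩ | ⟨hx, hy⟩)
      · exact Or.inl ⟨hy, hx, σ.symm h⟩
      · exact Or.inr ⟨hy, hx⟩
    · rintro x y z (⟨hx, hy, h⟩ | ⟨hx, hy⟩) (⟨hy', hz, h'⟩ | ⟨hy', hz⟩)
      · exact Or.inl ⟨hx, hz, σ.trans h h'⟩
      · omega
      · omega
      · exact Or.inr ⟨hx, hz⟩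

noncomputable instance setoidLFO (d : ℕ) : LocallyFiniteOrder (Setoid (Fin d)) :=
  Fintype.toLocallyFiniteOrder

/-- The Möbius function of the lattice of set partitions, with values in `ℚ`. -/
noncomputable def muS {d : ℕ} (a b : Setoid (Fin d)) : ℚ :=
  IncidenceAlgebra.mu ℚ a b

/-- Falling factorial `⟨m⟩_i = m(m-1)⋯(m-i+1)` as a rational number. -/
def ffact (m i : ℕ) : ℚ := ∏ j ∈ Finset.range i, ((m : ℚ) - j)

/-- Rising factorial `(b)_i = b(b+1)⋯(b+i-1)` as a rational number. -/
def rfact (b i : ℕ) : ℚ := ∏ j ∈ Finset.range i, ((b : ℚ) + j)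

/-- The path `P_{n+1}` with edges `v_i v_{i+1}`. -/
def pathEnds (n : ℕ) : Fin n → Sym2 (Fin (n + 1)) :=
  fun e => s(e.castSucc, e.succ)

/-- The cycle `C_{n+1}` with edges `v_i v_{i+1}` (indices mod `n+1`). -/
def cycleEnds (n : ℕ) : Fin (n + 1) → Sym2 (Fin (n + 1)) :=
  fun i => s(i, i + 1)

/-- The commutative chromatic symmetric function `X_G` in `N` variables. -/
noncomputable def Xcomm {d : ℕ} {ε : Type*} (ends : ε → Sym2 (Fin d)) (N : ℕ) :
    MvPolynomial (Fin N) ℚ :=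
  ∑ κ : Fin d → Fin N, if Proper ends κ then ∏ i, MvPolynomial.X (κ i) else 0

section Orientations

variable {V : Type*} {ε : Type*}

/-- `o` is an orientation of the graph with edge endpoints `ends`. -/
def IsOrient (ends : ε → Sym2 V) (o : ε → V × V) : Prop :=
  ∀ e, s((o e).1, (o e).2) = ends e

/-- An orientation is acyclic when it admits no directed cycle. -/
def Acyclic (o : ε → V × V) : Prop :=
  ∀ v : V, ¬ Relation.TransGen (fun a b => ∃ e, o e = (a, b)) v v

/-- `v` is a sink: every edge incident to `v` is directed toward `v`. -/
def IsSink (o : ε → V × V) (v : V) : Prop := ∀ e, (o e).1 ≠ v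

/-- The set of acyclic orientations with unique sink `v₀`. -/
def Aset (ends : ε → Sym2 V) (v₀ : V) : Set (ε → V × V) :=
  {o | IsOrient ends o ∧ Acyclic o ∧ IsSink o v₀ ∧ ∀ v, IsSink o v → v = v₀}

end Orientations

/-- A circuit: a closed walk `u_0, u_1, …, u_m, u_0` with distinct vertices and
distinct edges. -/
structure Circuit {d : ℕ} {ε : Type*} (ends : ε → Sym2 (Fin d)) where
  m : ℕ
  v : Fin (m + 1) → Fin d
  f : Fin (m + 1) → ε
  hv : Function.Injective v
  hf : Function.Injective f
  he : ∀ k, ends (f k) = s(v k, v (k + 1))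

/-- The broken circuit obtained from a circuit: its edge set with the largest
edge removed. -/
noncomputable def broken {d : ℕ} {ε : Type*} [LinearOrder ε] {ends : ε → Sym2 (Fin d)}
    (C : Circuit ends) : Finset ε :=
  (Finset.univ.image C.f).erase
    ((Finset.univ.image C.f).max'
      ⟨C.f 0, Finset.mem_image_of_mem _ (Finset.mem_univ _)⟩)

/-- `P(α)`: partitions `τ ≤ π+(d+1)` whose blocks can be listed as `B_1,…,B_l`
with `|B_i| = α_i` and `d+1 ∈ B_1`. -/
def Pset {d : ℕ} (π : Setoid (Fin (d + 1))) (l : ℕ) (α : Fin l → ℕ) :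
    Set (Setoid (Fin (d + 2))) :=
  {τ | τ ≤ addLast π ∧ ∃ B : Fin l → Finset (Fin (d + 2)),
    (∀ x y, τ x y ↔ ∃ i, x ∈ B i ∧ y ∈ B i) ∧
    (∀ i j, i ≠ j → Disjoint (B i) (B j)) ∧
    (∀ i, (B i).card = α i) ∧
    ∃ hl : 0 < l, Fin.last (d + 1) ∈ B ⟨0, hl⟩}

/-- `G + K_{m+1}` : attach a complete graph on `{v_{d}, v_{d+1}, …, v_{d+m}}`
(`m` new vertices) to the last vertex of a graph `G` on `d+1` vertices. -/
def attachEnds {d : ℕ} {ε : Type*} (ends : ε → Sym2 (Fin (d + 1))) (m : ℕ) :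
    ε ⊕ {p : Fin (m + 1) × Fin (m + 1) // p.1 < p.2} → Sym2 (Fin (d + 1 + m))
  | Sum.inl e => (ends e).map (fun x : Fin (d + 1) => (⟨(x : ℕ), by omega⟩ : Fin (d + 1 + m)))
  | Sum.inr p => s(⟨d + (p.1.1 : ℕ), by omega⟩, ⟨d + (p.1.2 : ℕ), by omega⟩)

/-- The disjoint union `G ⊎ K_m`, with the clique on the `m` new vertices. -/
def disjEnds {d : ℕ} {ε : Type*} (ends : ε → Sym2 (Fin d)) (m : ℕ) :
    ε ⊕ {p : Fin m × Fin m // p.1 < p.2} → Sym2 (Fin (d + m))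
  | Sum.inl e => (ends e).map (Fin.castAdd m)
  | Sum.inr p => s(Fin.natAdd d p.1.1, Fin.natAdd d p.1.2)

/-- The complete graph `K_{d+2}` minus the edge `v_{d+1} v_{d+2}`. -/
def kMinusEnds (d : ℕ) :
    {p : Fin (d + 2) × Fin (d + 2) //
      p.1 < p.2 ∧ ¬((p.1 : ℕ) = d ∧ (p.2 : ℕ) = d + 1)} → Sym2 (Fin (d + 2)) :=
  fun p => s(p.1.1, p.1.2)

noncomputable def eProd {N : ℕ} (p : Multiset ℕ) : MvPolynomial (Fin N) ℚ :=
  (p.map (fun k => MvPolynomial.esymm (Fin N) ℚ k)).prod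

/-- The partition obtained from `τ` by turning every element of `S` into a singleton. -/
def detach {n : ℕ} (S : Finset (Fin n)) (τ : Setoid (Fin n)) : Setoid (Fin n) where
  r i j := i = j ∨ (i ∉ S ∧ j ∉ S ∧ τ i j)
  iseqv := by
    constructor
    · intro x; exact Or.inl rfl
    · rintro x y (rfl | ⟨hx, hy, h⟩)
      · exact Or.inl rfl
      · exact Or.inr ⟨hy, hx, τ.symm h⟩
    · rintro x y z (rfl | ⟨hx, hy, h⟩) (rfl | ⟨hy', hz, h'⟩)
      · exact Or.inl rfl
      · exact Or.inr ⟨hy', hz, h'⟩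
      · exact Or.inr ⟨hx, hy, h⟩
      · exact Or.inr ⟨hx, hz, τ.trans h h'⟩

/-- The partition obtained from `τ` by detaching `D` and making it a single block. -/
def fuse {n : ℕ} (D : Finset (Fin n)) (τ : Setoid (Fin n)) : Setoid (Fin n) where
  r i j := (i ∈ D ∧ j ∈ D) ∨ (i ∉ D ∧ j ∉ D ∧ τ i j)
  iseqv := by
    constructor
    · intro x
      by_cases h : x ∈ D
      · exact Or.inl ⟨h, h⟩
      · exact Or.inr ⟨h, h, τ.refl _⟩
    · rintro x y (⟨hx, hy⟩ | ⟨hx, hy, h⟩)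
      · exact Or.inl ⟨hy, hx⟩
      · exact Or.inr ⟨hy, hx, τ.symm h⟩
    · rintro x y z (⟨hx, hy⟩ | ⟨hx, hy, h⟩) (⟨hy', hz⟩ | ⟨hy', hz, h'⟩)
      · exact Or.inl ⟨hx, hz⟩
      · exact absurd hy hy'
      · exact absurd hy' hy
      · exact Or.inr ⟨hx, hz, τ.trans h h'⟩

lemma detach_apply {n : ℕ} {S : Finset (Fin n)} {τ : Setoid (Fin n)} {i j : Fin n} :
    detach S τ i j ↔ i = j ∨ (i ∉ S ∧ j ∉ S ∧ τ i j) := Iff.rfl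

lemma fuse_apply {n : ℕ} {D : Finset (Fin n)} {τ : Setoid (Fin n)} {i j : Fin n} :
    fuse D τ i j ↔ (i ∈ D ∧ j ∈ D) ∨ (i ∉ D ∧ j ∉ D ∧ τ i j) := Iff.rfl

lemma detach_fuse {n : ℕ} (D : Finset (Fin n)) (τ : Setoid (Fin n)) :
    detach D (fuse D τ) = detach D τ := by
  ext i j
  simp only [detach_apply, fuse_apply]
  tauto

/-- Indicator of the words that are constant on `C ∪ {a}` and have distinct letters
within each block of `τ`. -/
noncomputable def tieFun {n : ℕ} (a : Fin n) (C : Finset (Fin n)) (τ : Setoid (Fin n)) : NCF n :=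
  fun w => if (∀ c ∈ C, w c = w a) ∧ (∀ i j, i ≠ j → τ i j → w i ≠ w j) then 1 else 0

lemma tieFun_singleton {n : ℕ} (a : Fin n) (τ : Setoid (Fin n)) :
    tieFun a {a} τ = eFun τ := by
  funext w
  simp [tieFun, eFun]

/-- Words constant on `C` in which the rest of the block `D` of `a` is rainbow: either the
letter at `a` is new, or it agrees with the letter at exactly one `b ∈ D \ C`. -/
lemma tieFun_detach {n : ℕ} {a : Fin n} {C D : Finset (Fin n)} {τ : Setoid (Fin n)}
    (ha : a ∈ C) (hD : ∀ j, τ a j ↔ j ∈ D) :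
    tieFun a C (detach C τ) = tieFun a C (detach (C.erase a) τ) +
      ∑ b ∈ D \ C, tieFun a (insert b C) (detach ((insert b C).erase a) τ) := by
  funext w
  simp only [Pi.add_apply, Finset.sum_apply]
  by_cases hC : ∀ c ∈ C, w c = w a
  swap
  · have h (b : Fin n) : ¬ ∀ c ∈ insert b C, w c = w a := fun h =>
      hC fun c hc => h c (Finset.mem_insert_of_mem hc)
    simp only [tieFun, hC, h, false_and, if_false, Finset.sum_const_zero, add_zero]
  by_cases hb : ∃ b ∈ D \ C, w b = w a
  · obtain ⟨b, hbD, hba⟩ := hb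
    obtain ⟨hbD, hbC⟩ := Finset.mem_sdiff.1 hbD
    have hne : b ≠ a := fun h => hbC (h ▸ ha)
    have h0 : tieFun a C (detach (C.erase a) τ) w = 0 := by
      refine if_neg fun h => h.2 a b hne.symm ?_ hba.symm
      simp [detach_apply, hbC, (hD b).2 hbD]
    have h1 : tieFun a (insert b C) (detach ((insert b C).erase a) τ) w =
        tieFun a C (detach C τ) w := by
      refine if_congr (and_congr ?_ ⟨fun h i j hij hr heq => ?_, fun h i j hij hr heq => ?_⟩)
        rfl rfl
      · simp [hba]
      · rw [detach_apply] at hr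
        obtain ⟨hi, hj, hτ⟩ := hr.resolve_left hij
        by_cases hib : i = b
        · subst hib
          have hja : a ≠ j := fun e => hj (e ▸ ha)
          refine h a j hja ?_ (hba ▸ heq)
          simp [detach_apply, hj, hja.symm, hij.symm, τ.trans ((hD i).2 hbD) hτ]
        by_cases hjb : j = b
        · subst hjb
          have hia : i ≠ a := fun e => hi (e ▸ ha)
          refine h i a hia ?_ (heq.trans hba)
          simp [detach_apply, hi, hia, hij, τ.trans hτ (τ.symm ((hD j).2 hbD))]
        · refine h i j hij ?_ heq
          simp [detach_apply, hi, hj, hib, hjb, hτ]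
      · rw [detach_apply] at hr
        obtain ⟨hi, hj, hτ⟩ := hr.resolve_left hij
        simp only [Finset.mem_erase, Finset.mem_insert, not_and, not_or] at hi hj
        by_cases hia : i = a
        · subst hia
          obtain ⟨hjb, hj⟩ := hj hij.symm
          refine h b j (Ne.symm hjb) ?_ (hba.trans heq)
          simp [detach_apply, hj, hbC, τ.trans (τ.symm ((hD b).2 hbD)) hτ]
        by_cases hja : j = a
        · subst hja
          obtain ⟨hib, hi⟩ := hi hij
          refine h i b hib ?_ (heq.trans hba.symm)
          simp [detach_apply, hi, hbC, τ.trans hτ ((hD b).2 hbD)]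
        · refine h i j hij ?_ heq
          simp [detach_apply, hi hia, hj hja, hτ]
    rw [h0, zero_add, Finset.sum_eq_single b, h1]
    · intro c _ hcb
      refine if_neg fun h => h.2 a b hne.symm ?_ hba.symm
      simp [detach_apply, hbC, Ne.symm hcb, (hD b).2 hbD]
    · simp [hbD, hbC]
  · rw [Finset.sum_eq_zero, add_zero]
    · refine if_congr (and_congr_right fun _ => ⟨fun h i j hij hr heq => ?_,
        fun h i j hij hr heq => ?_⟩) rfl rfl
      · rw [detach_apply] at hr
        obtain ⟨hi, hj, hτ⟩ := hr.resolve_left hij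
        simp only [Finset.mem_erase, not_and] at hi hj
        by_cases hia : i = a
        · subst hia
          exact hb ⟨j, Finset.mem_sdiff.2 ⟨(hD j).1 hτ, hj hij.symm⟩, heq.symm⟩
        by_cases hja : j = a
        · subst hja
          exact hb ⟨i, Finset.mem_sdiff.2 ⟨(hD i).1 (τ.symm hτ), hi hij⟩, heq⟩
        · refine h i j hij ?_ heq
          simp [detach_apply, hi hia, hj hja, hτ]
      · rw [detach_apply] at hr
        obtain ⟨hi, hj, hτ⟩ := hr.resolve_left hij
        refine h i j hij ?_ heq
        simp [detach_apply, hi, hj, hτ]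
    · intro b hbD
      exact if_neg fun h => hb ⟨b, hbD, h.1 b (Finset.mem_insert_self _ _)⟩

/-- Iterating `tieFun_detach` modulo a subspace containing the left-hand sides. -/
lemma tieFun_sub_mem {n : ℕ} {a : Fin n} {D : Finset (Fin n)} {τ : Setoid (Fin n)}
    (hD : ∀ j, τ a j ↔ j ∈ D) (W : Submodule ℚ (NCF n))
    (hW : ∀ C, a ∈ C → C ⊂ D → tieFun a C (detach C τ) ∈ W)
    (k : ℕ) (C : Finset (Fin n)) (ha : a ∈ C) (hCD : C ⊆ D) (hk : (D \ C).card = k) :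
    tieFun a C (detach (C.erase a) τ) -
      ((-1) ^ k * (k.factorial : ℚ)) • tieFun a D (detach D τ) ∈ W := by
  induction k generalizing C with
  | zero =>
    obtain rfl : C = D := hCD.antisymm (Finset.sdiff_eq_empty_iff_subset.1 (Finset.card_eq_zero.1 hk))
    simp [tieFun_detach ha hD]
  | succ k ih =>
    have hne : C ≠ D := by rintro rfl; simp at hk
    have hrec : ∀ b ∈ D \ C, tieFun a (insert b C) (detach ((insert b C).erase a) τ) -
        ((-1) ^ k * (k.factorial : ℚ)) • tieFun a D (detach D τ) ∈ W := by
      intro b hb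
      obtain ⟨hbD, hbC⟩ := Finset.mem_sdiff.1 hb
      refine ih _ (Finset.mem_insert_of_mem ha) (Finset.insert_subset hbD hCD) ?_
      rw [Finset.sdiff_insert, Finset.card_erase_of_mem hb, hk, Nat.add_sub_cancel]
    have h := W.sub_mem (hW C ha (hCD.ssubset_of_ne hne)) (W.sum_mem hrec)
    convert h using 1
    rw [tieFun_detach ha hD, Finset.sum_sub_distrib, Finset.sum_const, hk, Nat.factorial_succ,
      ← Nat.cast_smul_eq_nsmul ℚ, smul_smul]
    push_cast
    rw [show ((-1 : ℚ) ^ (k + 1) * (((k : ℚ) + 1) * (k.factorial : ℚ))) =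
      -(((k : ℚ) + 1) * ((-1) ^ k * (k.factorial : ℚ))) by ring]
    module

lemma tieFun_detach_mem_span {n : ℕ} {a : Fin n} (D : Finset (Fin n)) (ha : a ∈ D)
    (τ : Setoid (Fin n)) :
    tieFun a D (detach D τ) ∈ Submodule.span ℚ (Set.range (eFun (d := n))) := by
  induction D using Finset.strongInduction generalizing τ with
  | H D ih =>
    have hD : ∀ j, fuse D τ a j ↔ j ∈ D := fun j => by simp [fuse_apply, ha]
    have h := tieFun_sub_mem hD _ (fun C haC hC => ih C hC haC (fuse D τ)) _ {a}
      (Finset.mem_singleton_self a) (Finset.singleton_subset_iff.2 ha) rfl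
    have herase : detach (({a} : Finset (Fin n)).erase a) (fuse D τ) = fuse D τ := by
      ext i j
      simp only [detach_apply, Finset.erase_singleton, Finset.notMem_empty, not_false_eq_true,
        true_and, or_iff_right_iff_imp]
      rintro rfl
      exact (fuse D τ).refl _
    rw [herase, tieFun_singleton, detach_fuse] at h
    refine (Submodule.smul_mem_iff _ ?_).1 ((Submodule.sub_mem_iff_right _
      (Submodule.subset_span (Set.mem_range_self _))).1 h)
    exact mul_ne_zero (pow_ne_zero _ (by norm_num)) (Nat.cast_ne_zero.2 (Nat.factorial_ne_zero _))

lemma tieFun_erase_mem_span {n : ℕ} {a : Fin n} {D : Finset (Fin n)} {τ : Setoid (Fin n)}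
    (hD : ∀ j, τ a j ↔ j ∈ D) (C : Finset (Fin n)) (ha : a ∈ C) (hCD : C ⊆ D) :
    tieFun a C (detach (C.erase a) τ) ∈ Submodule.span ℚ (Set.range (eFun (d := n))) := by
  have h := tieFun_sub_mem hD _ (fun C haC _ => tieFun_detach_mem_span C haC τ) _ C ha hCD rfl
  exact (Submodule.sub_mem_iff_left _
    (Submodule.smul_mem _ _ (tieFun_detach_mem_span D (hCD ha) τ))).1 h

/-- The subspace of functions congruent to zero modulo `i`. -/
noncomputable def clsSpan {n : ℕ} (i : Fin n) : Submodule ℚ (NCF n) :=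
  Submodule.span ℚ {f | ∃ σ τ, cls i σ τ ∧ f = eFun σ - eFun τ}

lemma cls_congr_left {n : ℕ} {i : Fin n} {σ τ : Setoid (Fin n)} (h : cls i σ τ)
    (ρ : Setoid (Fin n)) : cls i σ ρ ↔ cls i τ ρ := by
  simp only [cls, h.1, h.2]

lemma sum_single_smul_eFun {n : ℕ} (σ : Setoid (Fin n)) (c : ℚ) :
    ∑ τ : Setoid (Fin n), (Pi.single σ c : Setoid (Fin n) → ℚ) τ • eFun τ = c • eFun σ := by
  rw [Finset.sum_eq_single σ] <;> simp +contextual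

lemma exists_coeff_of_mem_clsSpan {n : ℕ} {i : Fin n} {f : NCF n} (hf : f ∈ clsSpan i) :
    ∃ c : Setoid (Fin n) → ℚ, f = ∑ τ, c τ • eFun τ ∧
      ∀ ρ, (∑ σ : Setoid (Fin n), if cls i σ ρ then c σ else 0) = 0 := by
  induction hf using Submodule.span_induction with
  | mem f h =>
    obtain ⟨σ, τ, h, rfl⟩ := h
    refine ⟨Pi.single σ 1 - Pi.single τ 1, ?_, fun ρ => ?_⟩
    · simp only [Pi.sub_apply, sub_smul, Finset.sum_sub_distrib, sum_single_smul_eFun, one_smul]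
    · have hsingle (π : Setoid (Fin n)) :
          ∑ σ with cls i σ ρ, (Pi.single π 1 : Setoid (Fin n) → ℚ) σ =
            if cls i π ρ then 1 else 0 := by
        rw [Finset.sum_filter, Finset.sum_eq_single π] <;> simp +contextual
      simp only [← Finset.sum_filter, Pi.sub_apply, Finset.sum_sub_distrib, hsingle,
        cls_congr_left h, sub_self]
  | zero => exact ⟨0, by simp, by simp⟩
  | add f g _ _ hf hg =>
    obtain ⟨a, rfl, ha⟩ := hf
    obtain ⟨b, rfl, hb⟩ := hg
    refine ⟨a + b, by simp only [Pi.add_apply, add_smul, Finset.sum_add_distrib], fun ρ => ?_⟩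
    have := congrArg₂ (· + ·) (ha ρ) (hb ρ)
    simpa only [← Finset.sum_filter, Pi.add_apply, Finset.sum_add_distrib, add_zero] using this
  | smul r f _ hf =>
    obtain ⟨a, rfl, ha⟩ := hf
    refine ⟨r • a, by simp only [Pi.smul_apply, smul_assoc, Finset.smul_sum], fun ρ => ?_⟩
    have := congrArg (r * ·) (ha ρ)
    simpa only [← Finset.sum_filter, Pi.smul_apply, smul_eq_mul, Finset.mul_sum, mul_zero]
      using this

/-- A function congruent to an explicit `e`-expansion has an expansion with the same
amalgamated coefficients. -/
lemma exists_expansion_of_sub_mem_clsSpan {n : ℕ} {i : Fin n} {F : NCF n}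
    {b : Setoid (Fin n) → ℚ} (h : F - ∑ τ, b τ • eFun τ ∈ clsSpan i) :
    ∃ a : Setoid (Fin n) → ℚ, F = ∑ τ, a τ • eFun τ ∧
      ∀ τ, (∑ σ : Setoid (Fin n), if cls i σ τ then a σ else 0) =
        ∑ σ : Setoid (Fin n), if cls i σ τ then b σ else 0 := by
  obtain ⟨c, hc, hc0⟩ := exists_coeff_of_mem_clsSpan h
  refine ⟨b + c, ?_, fun τ => ?_⟩
  · simp only [Pi.add_apply, add_smul, Finset.sum_add_distrib, ← hc, add_sub_cancel]
  · have := hc0 τ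
    simp only [← Finset.sum_filter] at this
    simp only [← Finset.sum_filter, Pi.add_apply, Finset.sum_add_distrib, this, add_zero]

lemma act_eFun {n : ℕ} (δ : Equiv.Perm (Fin n)) (τ : Setoid (Fin n)) :
    act δ (eFun τ) = eFun (τ.comap δ.symm) := by
  funext w
  refine if_congr ⟨fun h i j hij hr => ?_, fun h i j hij hr => ?_⟩ rfl rfl
  · simpa using h (δ.symm i) (δ.symm j) (by simpa using hij) hr
  · exact h (δ i) (δ j) (by simpa using hij) (by simpa [Setoid.comap_rel] using hr)

lemma cls_comap {n : ℕ} {i : Fin n} {δ : Equiv.Perm (Fin n)} (hδ : δ i = i)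
    (τ : Setoid (Fin n)) : cls i τ (τ.comap δ.symm) := by
  have hblock (k : Fin n) : Finset.univ.filter (fun j => τ.comap δ.symm k j) =
      (Finset.univ.filter (fun j => τ (δ.symm k) j)).map δ.toEmbedding := by
    ext j
    simp [Setoid.comap_rel]
  constructor
  · have himage : Finset.univ.image (fun k => Finset.univ.filter (fun j => τ.comap δ.symm k j)) =
        (Finset.univ.image (fun k => Finset.univ.filter (fun j => τ k j))).map
          (Finset.mapEmbedding δ.toEmbedding).toEmbedding := by
      ext s
      simp only [hblock, Finset.mem_image, Finset.mem_map, Finset.mem_univ, true_and]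
      constructor
      · rintro ⟨k, rfl⟩
        exact ⟨_, ⟨δ.symm k, rfl⟩, rfl⟩
      · rintro ⟨_, ⟨k, rfl⟩, rfl⟩
        exact ⟨δ k, by simp⟩
    unfold sizes
    rw [himage, Finset.map_val, Multiset.map_map]
    refine Multiset.map_congr rfl fun s _ => ?_
    simp
  · unfold blockCard
    rw [hblock, Finset.card_map, δ.symm_apply_eq.2 hδ.symm]

lemma sub_act_mem_clsSpan {n : ℕ} {i : Fin n} {δ : Equiv.Perm (Fin n)} (hδ : δ i = i)
    {f : NCF n} (hf : f ∈ Submodule.span ℚ (Set.range (eFun (d := n)))) :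
    f - act δ f ∈ clsSpan i := by
  induction hf using Submodule.span_induction with
  | mem f h =>
    obtain ⟨τ, rfl⟩ := h
    rw [act_eFun]
    exact Submodule.subset_span ⟨_, _, cls_comap hδ τ, rfl⟩
  | zero => exact (clsSpan i).sub_mem (Submodule.zero_mem _) (Submodule.zero_mem _)
  | add f g _ _ hf hg =>
    convert (clsSpan i).add_mem hf hg using 1
    funext w
    simp only [act, Pi.add_apply, Pi.sub_apply]
    ring
  | smul r f _ hf =>
    convert (clsSpan i).smul_mem r hf using 1
    funext w
    simp only [act, Pi.smul_apply, Pi.sub_apply, smul_eq_mul]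
    ring

/-- Indicator of the words whose only coincidence is between the letters at `j` and `a`. -/
noncomputable def pairFun {n : ℕ} (a j : Fin n) : NCF n :=
  tieFun a {j, a} (detach {j} ⊤)

lemma pairFun_mem_span {n : ℕ} {a j : Fin n} (hj : j ≠ a) :
    pairFun a j ∈ Submodule.span ℚ (Set.range (eFun (d := n))) := by
  have h := tieFun_erase_mem_span (a := a) (D := Finset.univ) (τ := ⊤)
    (fun j => by simp) {j, a} (by simp) (Finset.subset_univ _)
  rwa [show ({j, a} : Finset (Fin n)).erase a = {j} by ext; simp; grind] at h

lemma act_pairFun {n : ℕ} (a j k : Fin n) (hj : j ≠ a) (hk : k ≠ a) :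
    act (Equiv.swap j k) (pairFun a j) = pairFun a k := by
  funext w
  have ha : Equiv.swap j k a = a := Equiv.swap_apply_of_ne_of_ne hj.symm hk.symm
  refine if_congr (and_congr ?_ ⟨fun h x y hxy hr => ?_, fun h x y hxy hr => ?_⟩) rfl rfl
  · simp [ha]
  · have hr := hr.resolve_left hxy
    have := h (Equiv.swap j k x) (Equiv.swap j k y) (by simpa using hxy) ?_
    · simpa using this
    · refine Or.inr ⟨?_, ?_, trivial⟩
      · simpa [Equiv.swap_apply_eq_iff] using hr.1
      · simpa [Equiv.swap_apply_eq_iff] using hr.2.1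
  · have hr := hr.resolve_left hxy
    refine h (Equiv.swap j k x) (Equiv.swap j k y) (by simpa using hxy) ?_
    refine Or.inr ⟨?_, ?_, trivial⟩
    · simpa [Equiv.swap_apply_eq_iff] using hr.1
    · simpa [Equiv.swap_apply_eq_iff] using hr.2.1

lemma detach_last_top (d : ℕ) :
    detach {Fin.last (d + 1)} (⊤ : Setoid (Fin (d + 2))) =
      addSingleton (⊤ : Setoid (Fin (d + 1))) := by
  ext i j
  have hi (i : Fin (d + 2)) : i ≠ Fin.last (d + 1) ↔ (i : ℕ) < d + 1 := by
    rw [ne_eq, Fin.ext_iff, Fin.val_last]; omega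
  simp only [detach_apply, Finset.mem_singleton, hi]
  change _ ↔ i = j ∨ (∃ (_ : (i : ℕ) < d + 1) (_ : (j : ℕ) < d + 1), True) ∨
    (((∃ _ : (i : ℕ) < d + 1, True) ∨ (d + 1 ≤ (i : ℕ) ∧ False)) ∧
     ((∃ _ : (j : ℕ) < d + 1, True) ∨ (d + 1 ≤ (j : ℕ) ∧ False)))
  have : (⊤ : Setoid (Fin (d + 2))) i j := trivial
  simp [this]

lemma eFun_addSingleton_top (d : ℕ) :
    eFun (addSingleton (⊤ : Setoid (Fin (d + 1)))) =
      eFun ⊤ + ∑ j : Fin (d + 1), pairFun (Fin.last (d + 1)) j.castSucc := by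
  have h := tieFun_detach (a := Fin.last (d + 1)) (C := {Fin.last (d + 1)}) (D := Finset.univ)
    (τ := ⊤) (by simp) (fun j => by simp)
  have h0 : detach (({Fin.last (d + 1)} : Finset _).erase (Fin.last (d + 1))) ⊤ = ⊤ := by
    ext i j; simp [detach_apply]
  rw [h0, tieFun_singleton, tieFun_singleton, detach_last_top] at h
  rw [h]
  congr 1
  rw [← Finset.sum_image (s := Finset.univ) (g := Fin.castSucc)
    (f := pairFun (Fin.last (d + 1))) (fun x _ y _ h => Fin.castSucc_injective _ h)]
  have hs : Finset.univ \ {Fin.last (d + 1)} = Finset.univ.image (Fin.castSucc (n := d + 1)) := by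
    ext x
    simp [← Fin.exists_castSucc_eq]
  rw [hs]
  refine Finset.sum_congr rfl fun b hb => ?_
  obtain ⟨c, -, rfl⟩ := Finset.mem_image.1 hb
  unfold pairFun
  congr 2
  ext x
  simp
  grind

lemma Y_kMinusEnds (d : ℕ) :
    Y (kMinusEnds d) = eFun ⊤ + pairFun (Fin.last (d + 1)) (Fin.last d).castSucc := by
  funext w
  have hP : Proper (kMinusEnds d) w ↔ ∀ i j : Fin (d + 2), i < j →
      ¬((i : ℕ) = d ∧ (j : ℕ) = d + 1) → w i ≠ w j := by
    constructor
    · intro h i j hij hne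
      exact h ⟨(i, j), hij, hne⟩ i j rfl
    · rintro h ⟨⟨x, y⟩, hxy, hne⟩ i j he
      rcases Sym2.eq_iff.1 he with ⟨rfl, rfl⟩ | ⟨rfl, rfl⟩
      · exact h _ _ hxy hne
      · exact (h _ _ hxy hne).symm
  have hvb (i : Fin (d + 2)) : i = (Fin.last d).castSucc ↔ (i : ℕ) = d := by
    simp [Fin.ext_iff]
  have hva (i : Fin (d + 2)) : i = Fin.last (d + 1) ↔ (i : ℕ) = d + 1 := by
    simp [Fin.ext_iff]
  by_cases hw : w (Fin.last d).castSucc = w (Fin.last (d + 1))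
  · have h0 : eFun ⊤ w = 0 := if_neg fun h => h _ _ (Fin.castSucc_lt_last _).ne trivial hw
    rw [Pi.add_apply, h0, zero_add]
    refine if_congr (hP.trans ⟨fun h => ⟨by simp [hw], fun i j hij hr => ?_⟩,
      fun h i j hij hne heq => ?_⟩) rfl rfl
    · obtain ⟨hi, hj, -⟩ := hr.resolve_left hij
      simp only [Finset.mem_singleton, hvb] at hi hj
      rcases lt_or_gt_of_ne hij with hlt | hlt
      · exact h i j hlt fun h => hi h.1
      · exact (h j i hlt fun h => hj h.1).symm
    · have hdist (k l : Fin (d + 2)) (hkl : k ≠ l) (hk : (k : ℕ) ≠ d) (hl : (l : ℕ) ≠ d) :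
          w k ≠ w l :=
        h.2 k l hkl (Or.inr ⟨by simpa [hvb] using hk, by simpa [hvb] using hl, trivial⟩)
      by_cases hi : (i : ℕ) = d
      · rw [Fin.lt_def] at hij
        have := j.isLt
        omega
      by_cases hj : (j : ℕ) = d
      · rw [(hvb j).2 hj, hw] at heq
        refine hdist i _ (fun h => ?_) hi (by simp) heq
        rw [hva] at h
        rw [Fin.lt_def] at hij
        omega
      · exact hdist i j hij.ne hi hj heq
  · have h0 : pairFun (Fin.last (d + 1)) (Fin.last d).castSucc w = 0 :=
      if_neg fun h => hw (h.1 _ (by simp))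
    rw [Pi.add_apply, h0, add_zero]
    refine if_congr (hP.trans ⟨fun h i j hij _ => ?_, fun h i j hij _ => h i j hij.ne trivial⟩)
      rfl rfl
    have hlt (k l : Fin (d + 2)) (hkl : k < l) : w k ≠ w l := by
      by_cases hne : (k : ℕ) = d ∧ (l : ℕ) = d + 1
      · rwa [(hvb k).2 hne.1, (hva l).2 hne.2]
      · exact h k l hkl hne
    rcases lt_or_gt_of_ne hij with hij | hij
    · exact hlt i j hij
    · exact (hlt j i hij).symm

lemma sub_mem_clsSpan (d : ℕ) :
    Y (kMinusEnds d) - (((d : ℚ) / ((d : ℚ) + 1)) • eFun (⊤ : Setoid (Fin (d + 2)))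
        + (1 / ((d : ℚ) + 1)) • eFun (addSingleton (⊤ : Setoid (Fin (d + 1))))) ∈
      clsSpan (Fin.last (d + 1)) := by
  have hne (j : Fin (d + 1)) : j.castSucc ≠ Fin.last (d + 1) := (Fin.castSucc_lt_last j).ne
  have h : ∑ j : Fin (d + 1), (pairFun (Fin.last (d + 1)) (Fin.last d).castSucc -
      pairFun (Fin.last (d + 1)) j.castSucc) ∈ clsSpan (Fin.last (d + 1)) := by
    refine Submodule.sum_mem _ fun j _ => ?_
    rw [← act_pairFun _ (Fin.last d).castSucc j.castSucc (hne _) (hne _)]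
    exact sub_act_mem_clsSpan (Equiv.swap_apply_of_ne_of_ne (hne _).symm (hne _).symm)
      (pairFun_mem_span (hne _))
  convert Submodule.smul_mem _ (1 / ((d : ℚ) + 1)) h using 1
  have hd : (d : ℚ) + 1 ≠ 0 := by positivity
  rw [Y_kMinusEnds, eFun_addSingleton_top, Finset.sum_sub_distrib, Finset.sum_const,
    Finset.card_univ, Fintype.card_fin, ← Nat.cast_smul_eq_nsmul ℚ]
  push_cast
  match_scalars <;> (field_simp; try ring)

/-- Letting the variables commute, and truncating to `N` variables. -/
noncomputable def commMap (d N : ℕ) : NCF d →ₗ[ℚ] MvPolynomial (Fin N) ℚ where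
  toFun f := ∑ κ : Fin d → Fin N, f (fun i => κ i) • ∏ i, MvPolynomial.X (κ i)
  map_add' f g := by simp only [Pi.add_apply, add_smul, Finset.sum_add_distrib]
  map_smul' r f := by
    simp only [Pi.smul_apply, smul_assoc, Finset.smul_sum, RingHom.id_apply]

lemma commMap_Y {d : ℕ} {ε : Type*} (ends : ε → Sym2 (Fin d)) (N : ℕ) :
    commMap d N (Y ends) = Xcomm ends N := by
  refine Finset.sum_congr rfl fun κ _ => ?_
  have : Proper ends (fun i => (κ i : ℕ)) ↔ Proper ends κ := by
    simp only [Proper, ne_eq, Fin.val_inj]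
  simp only [Y, this, ite_smul, one_smul, zero_smul]

lemma commMap_act {d : ℕ} (δ : Equiv.Perm (Fin d)) (f : NCF d) (N : ℕ) :
    commMap d N (act δ f) = commMap d N f := by
  refine Fintype.sum_equiv (δ.symm.arrowCongr (Equiv.refl (Fin N))) _ _ fun κ => ?_
  congr 1
  exact (Equiv.prod_comp δ fun i => MvPolynomial.X (κ i)).symm

lemma commMap_eFun_top (d N : ℕ) :
    commMap d N (eFun ⊤) = (d.factorial : ℚ) • MvPolynomial.esymm (Fin N) ℚ d := by
  have hinj (κ : Fin d → Fin N) :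
      (∀ i j, i ≠ j → (⊤ : Setoid (Fin d)) i j → (κ i : ℕ) ≠ κ j) ↔ Function.Injective κ := by
    constructor
    · intro h i j hij
      by_contra hne
      exact h i j hne trivial (congrArg _ hij)
    · intro h i j hij _ heq
      exact hij (h (Fin.ext heq))
  have h1 : commMap d N (eFun ⊤) =
      ∑ κ ∈ Finset.univ.filter (fun κ : Fin d → Fin N => Function.Injective κ),
        ∏ x ∈ Finset.univ.image κ, (MvPolynomial.X x : MvPolynomial (Fin N) ℚ) := by
    rw [Finset.sum_filter]
    refine Finset.sum_congr rfl fun κ _ => ?_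
    simp only [eFun, hinj, ite_smul, one_smul, zero_smul]
    split_ifs with h
    · rw [Finset.prod_image fun x _ y _ hxy => h hxy]
    · rfl
  rw [h1, MvPolynomial.esymm, Finset.smul_sum, ← Finset.sum_fiberwise_of_maps_to
    (t := Finset.powersetCard d Finset.univ) (g := fun κ => Finset.univ.image κ)]
  · refine Finset.sum_congr rfl fun s hs => ?_
    rw [Finset.sum_congr rfl (g := fun _ => ∏ x ∈ s, MvPolynomial.X x)
      (fun κ hκ => by rw [(Finset.mem_filter.1 hκ).2]), Finset.sum_const,
      ← Nat.cast_smul_eq_nsmul ℚ]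
    congr 2
    have hcard : s.card = d := (Finset.mem_powersetCard.1 hs).2
    have e : Fin d ≃ s := (finCongr hcard.symm).trans s.equivFin.symm
    have hfact : d.factorial = Fintype.card (Fin d ≃ s) := by
      rw [Fintype.card_equiv e, Fintype.card_fin]
    rw [hfact, ← Finset.card_univ, eq_comm]
    refine Finset.card_bij (fun g _ i => (g i : Fin N)) ?_ ?_ ?_
    · intro g _
      simp only [Finset.mem_filter, Finset.mem_univ, true_and]
      refine ⟨fun i j h => g.injective (Subtype.ext h), ?_⟩
      ext x
      simp only [Finset.mem_image, Finset.mem_univ, true_and]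
      exact ⟨fun ⟨i, hi⟩ => hi ▸ (g i).2, fun hx => ⟨g.symm ⟨x, hx⟩, by simp⟩⟩
    · intro g _ g' _ h
      exact Equiv.ext fun i => Subtype.ext (congrFun h i)
    · intro κ hκ
      simp only [Finset.mem_filter, Finset.mem_univ, true_and] at hκ
      obtain ⟨hκ, rfl⟩ := hκ
      refine ⟨Equiv.ofBijective (fun i => ⟨κ i, by simp⟩) ⟨fun i j h => hκ (by simpa using h), ?_⟩,
        Finset.mem_univ _, rfl⟩
      rintro ⟨x, hx⟩
      obtain ⟨i, -, rfl⟩ := Finset.mem_image.1 hx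
      exact ⟨i, rfl⟩
  · intro κ hκ
    rw [Finset.mem_powersetCard, Finset.card_image_of_injective _ (Finset.mem_filter.1 hκ).2]
    simp

lemma commMap_eFun_addSingleton_top (d N : ℕ) :
    commMap (d + 2) N (eFun (addSingleton (⊤ : Setoid (Fin (d + 1))))) =
      ((d + 1).factorial : ℚ) •
        (MvPolynomial.esymm (Fin N) ℚ (d + 1) * MvPolynomial.esymm (Fin N) ℚ 1) := by
  rw [← smul_mul_assoc, ← commMap_eFun_top, MvPolynomial.esymm_one]
  have hval (κ : Fin (d + 2) → Fin N) :
      eFun (addSingleton (⊤ : Setoid (Fin (d + 1)))) (fun i => (κ i : ℕ)) =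
        eFun (⊤ : Setoid (Fin (d + 1))) (fun i => (κ i.castSucc : ℕ)) := by
    rw [← detach_last_top]
    refine if_congr ⟨fun h i j hij _ => ?_, fun h i j hij hr => ?_⟩ rfl rfl
    · refine h _ _ (by simpa using hij) (Or.inr ⟨?_, ?_, trivial⟩) <;>
        simp [(Fin.castSucc_lt_last _).ne]
    · obtain ⟨hi, hj, -⟩ := hr.resolve_left hij
      obtain ⟨i, rfl⟩ := Fin.exists_castSucc_eq.2 (by simpa using hi)
      obtain ⟨j, rfl⟩ := Fin.exists_castSucc_eq.2 (by simpa using hj)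
      exact h i j (by simpa using hij) trivial
  change ∑ κ : Fin (d + 2) → Fin N, _ = (∑ κ : Fin (d + 1) → Fin N, _) * _
  rw [Finset.sum_mul_sum, ← Finset.sum_product', Finset.univ_product_univ, eq_comm]
  refine Fintype.sum_equiv ((Equiv.prodComm _ _).trans
    (Fin.snocEquiv fun _ : Fin (d + 2) => Fin N)) _ _ fun ⟨κ, x⟩ => ?_
  rw [hval, Fin.prod_univ_castSucc (n := d + 1), smul_mul_assoc]
  simp [Fin.snocEquiv]

/-- For the complete graph minus an edge (here on `d+2` vertices, so the paper's
`d` is `d+2`): `Y_{K_d - e} ≡_d ((d-2)/(d-1)) e_{([d])} + (1/(d-1)) e_{([d-1]/d)}`,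
it is `(e)`-positive, and
`X_{K_d - e} = d(d-2)(d-2)! e_d + (d-2)! e_{(d-1,1)}`. -/
theorem completeMinusEdge (d : ℕ) :
    EquivI (Fin.last (d + 1)) (Y (kMinusEnds d))
      (((d : ℚ) / ((d : ℚ) + 1)) • eFun (⊤ : Setoid (Fin (d + 2)))
        + (1 / ((d : ℚ) + 1)) • eFun (addSingleton (⊤ : Setoid (Fin (d + 1))))) ∧
    EPos (Fin.last (d + 1)) (Y (kMinusEnds d)) ∧
    ∀ N : ℕ, Xcomm (kMinusEnds d) N =
      (((d : ℚ) + 2) * (d : ℚ) * (Nat.factorial d : ℚ)) •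
          MvPolynomial.esymm (Fin N) ℚ (d + 2)
        + (Nat.factorial d : ℚ) •
          (MvPolynomial.esymm (Fin N) ℚ (d + 1) * MvPolynomial.esymm (Fin N) ℚ 1) := by
  have hG : ((d : ℚ) / ((d : ℚ) + 1)) • eFun (⊤ : Setoid (Fin (d + 2)))
        + (1 / ((d : ℚ) + 1)) • eFun (addSingleton (⊤ : Setoid (Fin (d + 1)))) =
      ∑ τ, (Pi.single ⊤ ((d : ℚ) / ((d : ℚ) + 1)) +
        Pi.single (addSingleton ⊤) (1 / ((d : ℚ) + 1)) : Setoid (Fin (d + 2)) → ℚ) τ •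
          eFun τ := by
    simp only [Pi.add_apply, add_smul, Finset.sum_add_distrib, sum_single_smul_eFun]
  have hmem := sub_mem_clsSpan d
  rw [hG] at hmem
  obtain ⟨a, ha, hab⟩ := exists_expansion_of_sub_mem_clsSpan hmem
  refine ⟨⟨a, _, ha, hG, hab⟩, ⟨a, ha, fun τ => ?_⟩, fun N => ?_⟩
  · rw [hab]
    refine Finset.sum_nonneg fun σ _ => ?_
    split_ifs
    · refine add_nonneg ?_ ?_ <;> rw [Pi.single_apply] <;> split_ifs <;> positivity
    · exact le_rfl
  · have hne (j : Fin (d + 1)) : j.castSucc ≠ Fin.last (d + 1) := (Fin.castSucc_lt_last j).ne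
    have hsum := congrArg (commMap (d + 2) N) (eFun_addSingleton_top d)
    rw [map_add, map_sum, Finset.sum_congr rfl (fun j _ => by
        rw [← act_pairFun _ (Fin.last d).castSucc j.castSucc (hne _) (hne _), commMap_act]),
      Finset.sum_const, Finset.card_univ, Fintype.card_fin, commMap_eFun_addSingleton_top,
      commMap_eFun_top, ← Nat.cast_smul_eq_nsmul ℚ] at hsum
    have hd : ((d + 1 : ℕ) : ℚ) ≠ 0 := by positivity
    rw [← commMap_Y, Y_kMinusEnds, map_add, commMap_eFun_top]
    refine (smul_right_inj hd).1 ?_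
    rw [smul_add, ← sub_eq_iff_eq_add'.2 hsum]
    simp only [Nat.factorial_succ]
    push_cast
    module
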